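/- arXiv:1511.07612 — 7 statements merged into one kernel-verified Lean document; each statement's English description precedes it below -/
import Mathlib

section
/- General minimax principle: Let E be a real Hilbert space and f : E → ℝ a function of class C^{1,1}. Let X : E → E be the vector field X(x) = −∇f(x)/√(1+‖∇f(x)‖²), and suppose φ : [0,∞) × E → E is a global flow of X, i.e. φ(0,x) = x for every x ∈ E and for every x the curve t ↦ φ(t,x) is differentiable with derivative X(φ(t,x)) at every t ≥ 0. Let Γ be a nonempty collection of nonempty subsets of E that is positively invariant under φ, i.e. for every A ∈ Γ and every t ≥ 0 the image set {φ(t,x) : x ∈ A} belongs to Γ. Assume the minimax value c := inf_{A∈Γ} sup_{x∈A} f(x) is a finite real number, i.e. c ∈ ℝ satisfies: for every A ∈ Γ and every ε > 0 there exists x ∈ A with f(x) > c − ε, and for every ε > 0 there exists A ∈ Γ with f(x) ≤ c + ε for all x ∈ A. Then f admits a Palais–Smale sequence at level c. In particular, if f satisfies the Palais–Smale condition at level c, then c is a critical value of f: there exists x ∈ E with f(x) = c and ∇f(x) = 0. -/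
open Filter Topology

/-- A function on `[0, ∞)` whose derivative is at most `-δ` on `[a, b]` drops by at least
`δ * (b - a)` over `[a, b]`. -/
lemma le_sub_mul_of_hasDerivWithinAt_le {h h' : ℝ → ℝ} {δ a b : ℝ} (ha : 0 ≤ a) (hab : a ≤ b)
    (hh : ∀ t, 0 ≤ t → HasDerivWithinAt h (h' t) (Set.Ici 0) t)
    (hle : ∀ t ∈ Set.Icc a b, h' t ≤ -δ) : h b ≤ h a - δ * (b - a) := by
  have hsub : Set.Icc a b ⊆ Set.Ici 0 := fun t ht => ha.trans ht.1
  have key : AntitoneOn (fun t => h t + δ * t) (Set.Icc a b) := by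
    refine antitoneOn_of_hasDerivWithinAt_nonpos (f' := fun t => h' t + δ * 1)
      (convex_Icc a b) ?_ ?_ ?_
    · intro t ht
      exact (((hh t (hsub ht)).mono hsub).continuousWithinAt).add (by fun_prop)
    · intro t ht
      have ht' := interior_subset ht
      exact ((hh t (hsub ht')).mono (interior_subset.trans hsub)).add
        ((hasDerivWithinAt_id t _).const_mul δ)
    · intro t ht
      linarith [hle t (interior_subset ht)]
  have := key (Set.left_mem_Icc.2 hab) (Set.right_mem_Icc.2 hab) hab
  simp only at this
  linarith

/-- Along the normalized negative gradient direction, `f` has derivative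
`-‖∇f‖² / √(1 + ‖∇f‖²)`. -/
lemma fderiv_neg_normalized_gradient
    {E : Type*} [NormedAddCommGroup E] [InnerProductSpace ℝ E] [CompleteSpace E]
    (f : E → ℝ) (x : E) :
    fderiv ℝ f x (-((Real.sqrt (1 + ‖gradient f x‖ ^ 2))⁻¹ • gradient f x)) =
      -(‖gradient f x‖ ^ 2 / Real.sqrt (1 + ‖gradient f x‖ ^ 2)) := by
  have h : fderiv ℝ f x (gradient f x) = ‖gradient f x‖ ^ 2 := by
    rw [← real_inner_self_eq_norm_sq]
    exact (InnerProductSpace.toDual_symm_apply ..).symm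
  rw [map_neg, map_smul, h, smul_eq_mul, div_eq_inv_mul]

lemma sq_div_one_add_le_sq_div_sqrt {ε a : ℝ} (hε : 0 < ε) (ha : ε ≤ a) :
    ε ^ 2 / (1 + ε) ≤ a ^ 2 / Real.sqrt (1 + a ^ 2) := by
  have ha0 : 0 < a := hε.trans_le ha
  have hs : Real.sqrt (1 + a ^ 2) ≤ 1 + a := Real.sqrt_le_iff.2 ⟨by positivity, by nlinarith⟩
  calc ε ^ 2 / (1 + ε) ≤ a ^ 2 / (1 + a) := by
        rw [div_le_div_iff₀ (by positivity) (by positivity)]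
        nlinarith [mul_pos hε ha0, mul_nonneg (mul_pos hε ha0).le (sub_nonneg.2 ha)]
    _ ≤ a ^ 2 / Real.sqrt (1 + a ^ 2) := by gcongr

/-- **General minimax principle.** Let `E` be a real Hilbert space and `f : E → ℝ` of class
`C^{1,1}` (differentiable with locally Lipschitz gradient). Let `X` be the normalized negative
gradient vector field and `φ` a global (forward) flow of `X`. If `Γ` is a nonempty collection of
nonempty subsets of `E`, positively invariant under `φ`, and the minimax value `c` is a finite
real number, then `f` admits a Palais–Smale sequence at level `c`; and if moreover `f` satisfies
the Palais–Smale condition at level `c`, then `c` is a critical value of `f`. -/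
theorem general_minimax_principle
    {E : Type*} [NormedAddCommGroup E] [InnerProductSpace ℝ E] [CompleteSpace E]
    (f : E → ℝ) (hf : Differentiable ℝ f)
    (hf' : LocallyLipschitz fun x => gradient f x)
    (X : E → E)
    (hX : ∀ x, X x = -((Real.sqrt (1 + ‖gradient f x‖ ^ 2))⁻¹ • gradient f x))
    (φ : ℝ → E → E)
    (hφ0 : ∀ x, φ 0 x = x)
    (hφ' : ∀ x : E, ∀ t ∈ Set.Ici (0 : ℝ),
      HasDerivWithinAt (fun s => φ s x) (X (φ t x)) (Set.Ici 0) t)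
    (Γ : Set (Set E)) (hΓ : Γ.Nonempty) (hΓne : ∀ A ∈ Γ, A.Nonempty)
    (hΓinv : ∀ A ∈ Γ, ∀ t : ℝ, 0 ≤ t → φ t '' A ∈ Γ)
    (c : ℝ)
    (hc₁ : ∀ A ∈ Γ, ∀ ε > (0 : ℝ), ∃ x ∈ A, c - ε < f x)
    (hc₂ : ∀ ε > (0 : ℝ), ∃ A ∈ Γ, ∀ x ∈ A, f x ≤ c + ε) :
    (∃ u : ℕ → E,
      Tendsto (fun n => f (u n)) atTop (𝓝 c) ∧
      Tendsto (fun n => ‖gradient f (u n)‖) atTop (𝓝 0)) ∧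
    ((∀ u : ℕ → E,
        Tendsto (fun n => f (u n)) atTop (𝓝 c) →
        Tendsto (fun n => ‖gradient f (u n)‖) atTop (𝓝 0) →
        ∃ (y : E) (ψ : ℕ → ℕ), StrictMono ψ ∧ Tendsto (fun n => u (ψ n)) atTop (𝓝 y)) →
      ∃ x : E, f x = c ∧ gradient f x = 0) := by
  have hderiv : ∀ x t, 0 ≤ t → HasDerivWithinAt (fun s => f (φ s x))
      (-(‖gradient f (φ t x)‖ ^ 2 / Real.sqrt (1 + ‖gradient f (φ t x)‖ ^ 2)))
      (Set.Ici 0) t := by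
    intro x t ht
    have h := (hf (φ t x)).hasFDerivAt.comp_hasDerivWithinAt t (hφ' x t ht)
    rwa [hX, fderiv_neg_normalized_gradient] at h
  have hanti : ∀ x a b, 0 ≤ a → a ≤ b → f (φ b x) ≤ f (φ a x) := by
    intro x a b ha hab
    have := le_sub_mul_of_hasDerivWithinAt_le (δ := 0) ha hab (hderiv x) fun t _ => by
      rw [neg_zero, neg_nonpos]; positivity
    linarith
  have hexists : ∀ ε > (0 : ℝ), ∃ x, |f x - c| ≤ ε ∧ ‖gradient f x‖ < ε := by
    intro ε hε
    by_contra! hcon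
    obtain ⟨A, hA, hAc⟩ := hc₂ ε hε
    set δ := ε ^ 2 / (1 + ε)
    have hδ : 0 < δ := by positivity
    have hT : 0 ≤ 2 * ε / δ := by positivity
    obtain ⟨_, ⟨x, hxA, rfl⟩, hx⟩ := hc₁ _ (hΓinv A hA _ hT) ε hε
    have hdrop := le_sub_mul_of_hasDerivWithinAt_le (δ := δ) le_rfl hT (hderiv x) fun t ht => by
      have hlo := hanti x t _ ht.1 ht.2
      have hhi := hanti x 0 t le_rfl ht.1
      rw [hφ0] at hhi
      have hfx := hAc x hxA
      exact neg_le_neg <| sq_div_one_add_le_sq_div_sqrt hε <|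
        hcon (φ t x) (abs_le.2 ⟨by linarith, by linarith⟩)
    rw [hφ0, sub_zero, mul_div_cancel₀ _ hδ.ne'] at hdrop
    linarith [hAc x hxA]
  have hPS : ∃ u : ℕ → E, Tendsto (fun n => f (u n)) atTop (𝓝 c) ∧
      Tendsto (fun n => ‖gradient f (u n)‖) atTop (𝓝 0) := by
    choose u hu using fun n : ℕ => hexists (1 / ((n : ℝ) + 1)) Nat.one_div_pos_of_nat
    have hlim := tendsto_one_div_add_atTop_nhds_zero_nat (𝕜 := ℝ)
    refine ⟨u, ?_, squeeze_zero (fun _ => norm_nonneg _) (fun n => (hu n).2.le) hlim⟩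
    rw [tendsto_iff_dist_tendsto_zero]
    exact squeeze_zero (fun _ => dist_nonneg) (fun n => (hu n).1) hlim
  refine ⟨hPS, fun hcompact => ?_⟩
  obtain ⟨u, hu, hu'⟩ := hPS
  obtain ⟨y, ψ, hψ, hy⟩ := hcompact u hu hu'
  refine ⟨y, ?_, ?_⟩
  · exact tendsto_nhds_unique ((hf.continuous.tendsto y).comp hy) (hu.comp hψ.tendsto_atTop)
  · exact norm_eq_zero.1 <| tendsto_nhds_unique ((hf'.continuous.norm.tendsto y).comp hy)
      (hu'.comp hψ.tendsto_atTop)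
end

section
/- Minimax principle with truncated flow: Let E be a real Hilbert space, f : E → ℝ of class C^{1,1}, and X(x) = −∇f(x)/√(1+‖∇f(x)‖²). Let b ∈ ℝ and let ρ : ℝ → ℝ be a smooth bounded function with ρ(t) = 0 for all t ≤ b and ρ(t) > 0 for all t > b. Suppose φ : [0,∞) × E → E is a global flow of the truncated vector field x ↦ ρ(f(x))·X(x), i.e. φ(0,x) = x for every x and for every x the curve t ↦ φ(t,x) has derivative ρ(f(φ(t,x)))·X(φ(t,x)) at every t ≥ 0. Let Γ be a nonempty collection of nonempty subsets of E that is positively invariant under φ (images of members of Γ under φ(t,·) belong to Γ for all t ≥ 0). Assume the minimax value c := inf_{A∈Γ} sup_{x∈A} f(x) is a finite real number and that c > b. Then f admits a Palais–Smale sequence at level c. -/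
open Filter Topology

/-- A function on `[0, T]` whose derivative is at most `-r` decreases by at least `r * T`. -/
theorem le_sub_mul_of_hasDerivWithinAt_le_s1 {g g' : ℝ → ℝ} {r T : ℝ} (hT : 0 ≤ T)
    (hg : ∀ t ∈ Set.Ici (0 : ℝ), HasDerivWithinAt g (g' t) (Set.Ici 0) t)
    (hr : ∀ t ∈ Set.Icc 0 T, g' t ≤ -r) :
    g T ≤ g 0 - r * T := by
  have hd : ∀ t ∈ Set.Icc 0 T, HasDerivWithinAt (fun t => g t + r * t) (g' t + r * 1)
      (Set.Icc 0 T) t := fun t ht =>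
    ((hg t ht.1).mono Set.Icc_subset_Ici_self).add ((hasDerivWithinAt_id t _).const_mul r)
  have anti : AntitoneOn (fun t => g t + r * t) (Set.Icc 0 T) := by
    refine antitoneOn_of_hasDerivWithinAt_nonpos (convex_Icc 0 T)
      (fun t ht => (hd t ht).continuousWithinAt)
      (fun t ht => (hd t (interior_subset ht)).mono interior_subset) fun t ht => ?_
    linarith [hr t (interior_subset ht)]
  have := anti (Set.left_mem_Icc.2 hT) (Set.right_mem_Icc.2 hT) hT
  simp only [mul_zero, add_zero] at this
  linarith

theorem sq_div_one_add_le_inv_sqrt_mul_sq {s ε : ℝ} (hε : 0 < ε) (hs : ε ≤ s) :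
    ε ^ 2 / (1 + ε) ≤ (Real.sqrt (1 + s ^ 2))⁻¹ * s ^ 2 := by
  have hs0 : 0 < s := hε.trans_le hs
  have hsqrt : Real.sqrt (1 + s ^ 2) ≤ 1 + s := Real.sqrt_le_iff.2 ⟨by positivity, by nlinarith⟩
  have hsqrt_pos : 0 < Real.sqrt (1 + s ^ 2) := Real.sqrt_pos.2 (by positivity)
  calc ε ^ 2 / (1 + ε) ≤ s ^ 2 / (1 + s) := by
        rw [div_le_div_iff₀ (by positivity) (by positivity)]
        nlinarith [mul_nonneg (sub_nonneg.2 hs) (by positivity : 0 ≤ s + ε + s * ε)]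
    _ = (1 + s)⁻¹ * s ^ 2 := by rw [div_eq_inv_mul]
    _ ≤ _ := by gcongr

/-- If for every `ε` there is an `ε`-almost critical point at an `ε`-almost `c` value, then there
is a Palais–Smale sequence at level `c`. -/
theorem exists_tendsto_gradient_of_forall_exists
    {E : Type*} [NormedAddCommGroup E] [InnerProductSpace ℝ E] [CompleteSpace E]
    {f : E → ℝ} {c : ℝ}
    (h : ∀ ε > (0 : ℝ), ∃ x, |f x - c| ≤ ε ∧ ‖gradient f x‖ < ε) :
    ∃ u : ℕ → E,
      Tendsto (fun n => f (u n)) atTop (𝓝 c) ∧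
      Tendsto (fun n => ‖gradient f (u n)‖) atTop (𝓝 0) := by
  choose u hu hu' using fun n : ℕ => h (1 / ((n : ℝ) + 1)) Nat.one_div_pos_of_nat
  have lim := tendsto_one_div_add_atTop_nhds_zero_nat (𝕜 := ℝ)
  refine ⟨u, ?_, squeeze_zero (fun n => norm_nonneg _) (fun n => (hu' n).le) lim⟩
  rw [tendsto_iff_dist_tendsto_zero]
  exact squeeze_zero (fun n => dist_nonneg) hu lim

/-- **Minimax principle with truncated flow.** Let `E` be a real Hilbert space, `f : E → ℝ` of
class `C^{1,1}`, `X` the normalized negative gradient vector field, `ρ : ℝ → ℝ` a smooth bounded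
cut-off vanishing on `(-∞, b]` and positive on `(b, ∞)`, and `φ` a global forward flow of the
truncated vector field `x ↦ ρ(f(x)) • X(x)`. If `Γ` is a nonempty collection of nonempty subsets
of `E`, positively invariant under `φ`, and the minimax value `c` is a finite real number with
`c > b`, then `f` admits a Palais–Smale sequence at level `c`. -/
theorem minimax_principle_truncated_flow
    {E : Type*} [NormedAddCommGroup E] [InnerProductSpace ℝ E] [CompleteSpace E]
    (f : E → ℝ) (hf : Differentiable ℝ f)
    (hf' : LocallyLipschitz fun x => gradient f x)
    (X : E → E)
    (hX : ∀ x, X x = -((Real.sqrt (1 + ‖gradient f x‖ ^ 2))⁻¹ • gradient f x))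
    (b : ℝ) (ρ : ℝ → ℝ) (hρ : ContDiff ℝ (⊤ : ℕ∞) ρ) (hρbdd : ∃ C, ∀ t, |ρ t| ≤ C)
    (hρ0 : ∀ t ≤ b, ρ t = 0) (hρpos : ∀ t > b, 0 < ρ t)
    (φ : ℝ → E → E)
    (hφ0 : ∀ x, φ 0 x = x)
    (hφ' : ∀ x : E, ∀ t ∈ Set.Ici (0 : ℝ),
      HasDerivWithinAt (fun s => φ s x) (ρ (f (φ t x)) • X (φ t x)) (Set.Ici 0) t)
    (Γ : Set (Set E)) (hΓ : Γ.Nonempty) (hΓne : ∀ A ∈ Γ, A.Nonempty)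
    (hΓinv : ∀ A ∈ Γ, ∀ t : ℝ, 0 ≤ t → φ t '' A ∈ Γ)
    (c : ℝ)
    (hc₁ : ∀ A ∈ Γ, ∀ ε > (0 : ℝ), ∃ x ∈ A, c - ε < f x)
    (hc₂ : ∀ ε > (0 : ℝ), ∃ A ∈ Γ, ∀ x ∈ A, f x ≤ c + ε)
    (hcb : b < c) :
    ∃ u : ℕ → E,
      Tendsto (fun n => f (u n)) atTop (𝓝 c) ∧
      Tendsto (fun n => ‖gradient f (u n)‖) atTop (𝓝 0) := by
  apply exists_tendsto_gradient_of_forall_exists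
  intro ε hε
  by_contra! hgrad
  have hρnonneg : ∀ t, 0 ≤ ρ t := fun t =>
    (le_or_gt t b).elim (fun h => (hρ0 t h).ge) fun h => (hρpos t h).le
  obtain ⟨δ, hδ, hδε, hδb⟩ : ∃ δ > 0, δ ≤ ε ∧ b < c - δ :=
    ⟨min ε ((c - b) / 2), lt_min hε (by linarith), min_le_left _ _,
      by linarith [min_le_right ε ((c - b) / 2)]⟩
  obtain ⟨t₀, ht₀, hmin⟩ := isCompact_Icc.exists_isMinOn
    (Set.nonempty_Icc.2 (by linarith : c - δ ≤ c + δ)) hρ.continuous.continuousOn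
  have hm : 0 < ρ t₀ := hρpos t₀ (hδb.trans_le ht₀.1)
  set k := ε ^ 2 / (1 + ε)
  have hk : 0 < k := by positivity
  have hmk : 0 < ρ t₀ * k := mul_pos hm hk
  obtain ⟨A, hA, hAle⟩ := hc₂ δ hδ
  set T := 2 * δ / (ρ t₀ * k)
  have hT : 0 ≤ T := by positivity
  obtain ⟨_, ⟨x, hxA, rfl⟩, hx⟩ := hc₁ _ (hΓinv A hA T hT) δ hδ
  let N : E → ℝ := fun y => (Real.sqrt (1 + ‖gradient f y‖ ^ 2))⁻¹ * ‖gradient f y‖ ^ 2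
  have hN : ∀ y, 0 ≤ N y := fun y => by positivity
  have hderiv : ∀ t ∈ Set.Ici (0 : ℝ), HasDerivWithinAt (fun s => f (φ s x))
      (-(ρ (f (φ t x)) * N (φ t x))) (Set.Ici 0) t := by
    intro t ht
    have := (hf (φ t x)).hasGradientAt.hasFDerivAt.comp_hasDerivWithinAt t (hφ' x t ht)
    exact this.congr_deriv (by
      rw [InnerProductSpace.toDual_apply_apply, hX, inner_smul_right, inner_neg_right,
        inner_smul_right, real_inner_self_eq_norm_sq, mul_neg])
  have anti : AntitoneOn (fun s => f (φ s x)) (Set.Ici 0) :=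
    antitoneOn_of_hasDerivWithinAt_nonpos (convex_Ici 0)
      (fun t ht => (hderiv t ht).continuousWithinAt)
      (fun t ht => (hderiv t (interior_subset ht)).mono interior_subset)
      fun t _ => neg_nonpos.2 (mul_nonneg (hρnonneg _) (hN _))
  have hdecr := le_sub_mul_of_hasDerivWithinAt_le_s1 (r := ρ t₀ * k) hT hderiv fun t ht => by
    have hlow : f (φ T x) ≤ f (φ t x) := anti ht.1 hT ht.2
    have hupp : f (φ t x) ≤ f (φ 0 x) := anti Set.self_mem_Ici ht.1 ht.1
    rw [hφ0] at hupp
    have hxle := hAle x hxA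
    have hg : ε ≤ ‖gradient f (φ t x)‖ :=
      hgrad _ (abs_le.2 ⟨by linarith, by linarith⟩)
    have hρt : ρ t₀ ≤ ρ (f (φ t x)) := hmin ⟨by linarith, by linarith⟩
    exact neg_le_neg (mul_le_mul hρt (sq_div_one_add_le_inv_sqrt_mul_sq hε hg) hk.le (hρnonneg _))
  have hTmul : ρ t₀ * k * T = 2 * δ := mul_div_cancel₀ _ hmk.ne'
  rw [hφ0] at hdecr
  linarith [hAle x hxA]
end

section
/- Mountain pass theorem: Let E be a real Hilbert space and f : E → ℝ of class C^{1,1}. Suppose that for some a ∈ ℝ the sublevel set {x ∈ E : f(x) < a} is not connected: there are nonempty disjoint open sets A, B ⊆ E with {x : f(x) < a} = A ∪ B. Let c := inf over all continuous paths γ : [0,1] → E with γ(0) ∈ A and γ(1) ∈ B of max_{s∈[0,1]} f(γ(s)). Then c is a well-defined real number with c ≥ a, and f admits a Palais–Smale sequence at level c. In particular, if f satisfies the Palais–Smale condition at level c, then c is a critical value of f: there exists x ∈ E with f(x) = c and ∇f(x) = 0. -/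
open Filter Topology

/-- **Ekeland's variational principle**, weak form. -/
theorem exists_le_forall_le_add_mul_dist {X : Type*} [MetricSpace X] [CompleteSpace X]
    {Φ : X → ℝ} (hΦ : LowerSemicontinuous Φ) (hbdd : BddBelow (Set.range Φ))
    {ε : ℝ} (hε : 0 < ε) (x₀ : X) :
    ∃ y, Φ y ≤ Φ x₀ ∧ ∀ z, Φ y ≤ Φ z + ε * dist y z := by
  let S : X → Set X := fun x => {z | Φ z + ε * dist x z ≤ Φ x}
  have hS_closed : ∀ x, IsClosed (S x) := fun x => by
    have h : LowerSemicontinuous fun z => Φ z + ε * dist x z :=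
      hΦ.add (Continuous.lowerSemicontinuous (by fun_prop))
    exact h.isClosed_preimage (Φ x)
  have hS_self : ∀ x, x ∈ S x := fun x => by simp [S]
  have hS_trans : ∀ {x y z}, y ∈ S x → z ∈ S y → z ∈ S x := by
    intro x y z hy hz
    simp only [S, Set.mem_ofPred_eq] at hy hz ⊢
    nlinarith [dist_triangle x y z]
  have hbddS : ∀ x, BddBelow (Φ '' S x) := fun x => hbdd.mono (Set.image_subset_range _ _)
  have hstep : ∀ (n : ℕ) (x : X), ∃ y ∈ S x, ∀ z ∈ S x, Φ y ≤ Φ z + (1 / 2 : ℝ) ^ n := by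
    intro n x
    obtain ⟨_, ⟨y, hy, rfl⟩, hlt⟩ := exists_lt_of_csInf_lt (s := Φ '' S x)
      ⟨_, Set.mem_image_of_mem _ (hS_self x)⟩
      (lt_add_of_pos_right (sInf (Φ '' S x)) (show (0 : ℝ) < (1 / 2) ^ n by positivity))
    exact ⟨y, hy, fun z hz => hlt.le.trans
      (by gcongr; exact csInf_le (hbddS x) (Set.mem_image_of_mem _ hz))⟩
  choose g hgS hg using hstep
  let u : ℕ → X := fun n => Nat.rec x₀ (fun k x => g k x) n
  have hu : ∀ n, u (n + 1) = g n (u n) := fun _ => rfl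
  have hmem : ∀ {n m}, n ≤ m → u m ∈ S (u n) := by
    intro n m hnm
    induction m, hnm using Nat.le_induction with
    | base => exact hS_self _
    | succ k _ ih => exact hS_trans ih (hu k ▸ hgS k (u k))
  have hclose : ∀ n, ∀ z ∈ S (u (n + 1)), ε * dist (u (n + 1)) z ≤ (1 / 2 : ℝ) ^ n := by
    intro n z hz
    have h := hg n (u n) z (hS_trans (hmem n.le_succ) hz)
    rw [← hu] at h
    simp only [S, Set.mem_ofPred_eq] at hz
    linarith
  have hclose' : ∀ n, ∀ z ∈ S (u (n + 1)), dist (u (n + 1)) z ≤ (1 / 2 : ℝ) ^ n / ε :=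
    fun n z hz => by rw [le_div_iff₀ hε, mul_comm]; exact hclose n z hz
  have hlim : Tendsto (fun n : ℕ => (1 / 2 : ℝ) ^ n / ε) atTop (𝓝 0) := by
    simpa using (tendsto_pow_atTop_nhds_zero_of_lt_one (r := (1 / 2 : ℝ))
      (by norm_num) (by norm_num)).div_const ε
  have hcauchy : CauchySeq fun n => u (n + 1) :=
    cauchySeq_of_le_tendsto_0' _
      (fun n m hnm => hclose' n _ (hmem (Nat.succ_le_succ hnm))) hlim
  obtain ⟨y, hy⟩ := cauchySeq_tendsto_of_complete hcauchy
  have hyS : ∀ n, y ∈ S (u n) := fun n =>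
    (hS_closed _).mem_of_tendsto hy <| (eventually_ge_atTop n).mono fun m hm =>
      hmem (hm.trans m.le_succ)
  have hyu : Φ y ≤ Φ x₀ := by
    have h : Φ y + ε * dist x₀ y ≤ Φ x₀ := hyS 0
    nlinarith [dist_nonneg (x := x₀) (y := y)]
  refine ⟨y, hyu, fun z => ?_⟩
  by_contra! hz
  have hzS : ∀ n, z ∈ S (u n) := fun n => hS_trans (hyS n) hz.le
  have hyz : Tendsto (fun n => u (n + 1)) atTop (𝓝 z) :=
    tendsto_iff_dist_tendsto_zero.2 <|
      squeeze_zero (fun _ => dist_nonneg) (fun n => hclose' n z (hzS (n + 1))) hlim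
  simp [tendsto_nhds_unique hy hyz] at hz

section MaxAlong

variable {K E : Type*} [TopologicalSpace K] [CompactSpace K]

theorem bddAbove_range_comp_continuousMap [TopologicalSpace E] {f : E → ℝ} (hf : Continuous f)
    (γ : C(K, E)) : BddAbove (Set.range fun s => f (γ s)) :=
  (isCompact_range (hf.comp γ.continuous)).bddAbove

theorem exists_eq_iSup_comp_continuousMap [Nonempty K] [TopologicalSpace E] {f : E → ℝ}
    (hf : Continuous f) (γ : C(K, E)) : ∃ s, f (γ s) = ⨆ r, f (γ r) :=
  (isCompact_range (hf.comp γ.continuous)).sSup_mem (Set.range_nonempty _)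

theorem lowerSemicontinuous_iSup_comp_continuousMap [TopologicalSpace E] {f : E → ℝ}
    (hf : Continuous f) : LowerSemicontinuous fun γ : C(K, E) => ⨆ s, f (γ s) :=
  lowerSemicontinuous_ciSup (bddAbove_range_comp_continuousMap hf) fun s =>
    (hf.comp (continuous_eval_const s)).lowerSemicontinuous

variable [NormedAddCommGroup E] [InnerProductSpace ℝ E] [CompleteSpace E]

theorem exists_sub_eq_inner_gradient {f : E → ℝ} (hf : Differentiable ℝ f) (x y : E) :
    ∃ z ∈ segment ℝ x y, f y - f x = inner ℝ (gradient f z) (y - x) := by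
  obtain ⟨z, hz, h⟩ := domain_mvt (f := f) (s := Set.univ) (x := x) (y := y)
    (fun w _ => (hf w).hasGradientAt.hasFDerivAt.hasFDerivWithinAt) convex_univ trivial trivial
  exact ⟨z, hz, by simpa using h⟩

/-- If translating `γ` along `-t • w` decreases the maximum of `f` at rate at most `ε`, then the
directional derivative of `f` along `w` is at most `ε` at some maximum point of `f` on `γ`. -/
theorem exists_inner_gradient_le_of_iSup_le [Nonempty K] [FirstCountableTopology K]
    {f : E → ℝ} (hf : Differentiable ℝ f) (hf' : Continuous (gradient f)) {ε : ℝ}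
    (γ w : C(K, E))
    (hw : ∀ t : ℝ, 0 < t → ⨆ s, f (γ s) ≤ (⨆ s, f ((γ - t • w) s)) + ε * t) :
    ∃ s, f (γ s) = ⨆ r, f (γ r) ∧ inner ℝ (gradient f (γ s)) (w s) ≤ ε := by
  have hfc := hf.continuous
  let t : ℕ → ℝ := fun n => 1 / ((n : ℝ) + 1)
  have ht : ∀ n, 0 < t n := fun n => Nat.one_div_pos_of_nat
  have ht0 : Tendsto t atTop (𝓝 0) := tendsto_one_div_add_atTop_nhds_zero_nat
  choose s hs using fun n => exists_eq_iSup_comp_continuousMap hfc (γ - t n • w)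
  choose z hz hzf using fun n =>
    exists_sub_eq_inner_gradient hf ((γ - t n • w) (s n)) (γ (s n))
  have hle : ∀ n, ⨆ r, f (γ r) ≤ f ((γ - t n • w) (s n)) + ε * t n := fun n => by
    rw [hs]; exact hw _ (ht n)
  have hinner : ∀ n, inner ℝ (gradient f (z n)) (w (s n)) ≤ ε := by
    intro n
    have h1 := hzf n
    have h2 := hle n
    have h3 := le_ciSup (bddAbove_range_comp_continuousMap hfc γ) (s n)
    have h4 : γ (s n) - (γ - t n • w) (s n) = t n • w (s n) := by simp
    rw [h4, real_inner_smul_right] at h1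
    refine le_of_mul_le_mul_left ?_ (ht n)
    linarith
  obtain ⟨p, φ, hφ, hp⟩ := CompactSpace.tendsto_subseq s
  have htφ : Tendsto (fun n => t (φ n)) atTop (𝓝 0) := ht0.comp hφ.tendsto_atTop
  have hγp : Tendsto (fun n => γ (s (φ n))) atTop (𝓝 (γ p)) := (γ.continuous.tendsto p).comp hp
  have hwp : Tendsto (fun n => w (s (φ n))) atTop (𝓝 (w p)) := (w.continuous.tendsto p).comp hp
  have hqp : Tendsto (fun n => (γ - t (φ n) • w) (s (φ n))) atTop (𝓝 (γ p)) := by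
    simpa using hγp.sub (htφ.smul hwp)
  have hzp : Tendsto (fun n => z (φ n)) atTop (𝓝 (γ p)) := by
    have h0 : Tendsto (fun n => z (φ n) - γ (s (φ n))) atTop (𝓝 0) := by
      have hd : Tendsto (fun n => ‖(γ - t (φ n) • w) (s (φ n)) - γ (s (φ n))‖) atTop (𝓝 0) := by
        simpa only [sub_self, norm_zero] using (hqp.sub hγp).norm
      exact squeeze_zero_norm (fun n => norm_sub_le_of_mem_segment
        (segment_symm ℝ _ (γ (s (φ n))) ▸ hz (φ n))) hd
    simpa using h0.add hγp
  refine ⟨p, le_antisymm (le_ciSup (bddAbove_range_comp_continuousMap hfc γ) p) ?_, ?_⟩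
  · refine ge_of_tendsto' (x := atTop)
      (f := fun n => f ((γ - t (φ n) • w) (s (φ n))) + ε * t (φ n)) ?_ fun n => hle (φ n)
    simpa using ((hfc.tendsto _).comp hqp).add (htφ.const_mul ε)
  · exact le_of_tendsto' (((hf'.tendsto _).comp hzp).inner hwp) fun n => hinner (φ n)

end MaxAlong

section UnitInterval

variable {E : Type*} [NormedAddCommGroup E] [InnerProductSpace ℝ E] [CompleteSpace E]

/-- If the maximum of `f` on `γ` exceeds the values at the endpoints and cannot be decreased at
rate more than `ε` keeping the endpoints fixed, then the gradient of `f` has norm at most `ε` at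
some maximum point of `f` on `γ`. -/
theorem exists_norm_gradient_le_of_iSup_le {f : E → ℝ} (hf : Differentiable ℝ f)
    (hf' : Continuous (gradient f)) {ε : ℝ} (hε : 0 < ε) (γ : C(unitInterval, E))
    (h0 : f (γ 0) < ⨆ s, f (γ s)) (h1 : f (γ 1) < ⨆ s, f (γ s))
    (hγ : ∀ σ : C(unitInterval, E), σ 0 = γ 0 → σ 1 = γ 1 →
      ⨆ s, f (γ s) ≤ (⨆ s, f (σ s)) + ε * dist γ σ) :
    ∃ s, f (γ s) = ⨆ r, f (γ r) ∧ ‖gradient f (γ s)‖ ≤ ε := by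
  have hfc := hf.continuous
  set M := ⨆ r, f (γ r) with hM
  set b := max (f (γ 0)) (f (γ 1)) with hb
  have hbM : 0 < M - b := sub_pos.2 (max_lt h0 h1)
  let χ : unitInterval → ℝ := fun s => max 0 ((f (γ s) - b) / (M - b))
  let N : unitInterval → ℝ := fun s => max ‖gradient f (γ s)‖ ε
  have hN : ∀ s, 0 < N s := fun s => hε.trans_le (le_max_right _ _)
  let w : C(unitInterval, E) := ⟨fun s => (χ s / N s) • gradient f (γ s), by
    have hχc : Continuous χ := by fun_prop
    have hNc : Continuous N := by fun_prop
    exact (hχc.div hNc fun s => (hN s).ne').smul (hf'.comp γ.continuous)⟩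
  have hχ0 : ∀ s, 0 ≤ χ s := fun s => le_max_left _ _
  have hχ1 : ∀ s, χ s ≤ 1 := fun s => max_le zero_le_one <| by
    rw [div_le_one hbM]
    have : f (γ s) ≤ M := le_ciSup (bddAbove_range_comp_continuousMap hfc γ) s
    linarith
  have hχ_of_le : ∀ s, f (γ s) ≤ b → χ s = 0 := fun s hs =>
    max_eq_left (div_nonpos_of_nonpos_of_nonneg (sub_nonpos.2 hs) hbM.le)
  have hw1 : ∀ s, ‖w s‖ ≤ 1 := fun s => by
    have h : ‖w s‖ = χ s / N s * ‖gradient f (γ s)‖ := by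
      simp [w, norm_smul, abs_of_nonneg (hχ0 s), abs_of_pos (hN s)]
    rw [h, div_mul_eq_mul_div, div_le_one (hN s)]
    exact (mul_le_of_le_one_left (norm_nonneg _) (hχ1 s)).trans (le_max_left _ _)
  have hwz : ∀ s, f (γ s) ≤ b → w s = 0 := fun s hs => by simp [w, hχ_of_le s hs]
  obtain ⟨s, hsM, hs⟩ := exists_inner_gradient_le_of_iSup_le (ε := ε) hf hf' γ w fun t ht => by
    refine (hγ (γ - t • w) (by simp [hwz 0 (le_max_left _ _)])
      (by simp [hwz 1 (le_max_right _ _)])).trans ?_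
    gcongr
    refine (ContinuousMap.dist_le ht.le).2 fun s => ?_
    simpa [dist_eq_norm, norm_smul, abs_of_pos ht] using mul_le_of_le_one_right ht.le (hw1 s)
  refine ⟨s, hsM, ?_⟩
  by_contra! hlt
  have hχs : χ s = 1 := by simp [χ, hsM, ← hM, hbM.ne']
  have hNs : N s = ‖gradient f (γ s)‖ := max_eq_left hlt.le
  have hpos : ‖gradient f (γ s)‖ ≠ 0 := (hε.trans hlt).ne'
  have : inner ℝ (gradient f (γ s)) (w s) = ‖gradient f (γ s)‖ := by
    simp only [w, ContinuousMap.coe_mk, hχs, hNs, real_inner_smul_right,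
      real_inner_self_eq_norm_sq]
    field_simp
  linarith

/-- If every path joining the endpoints of `γ₀` reaches level `c`, above the values of `f` at the
endpoints, then near the level of `γ₀` there is a point where the gradient of `f` is small. -/
theorem exists_norm_gradient_le_of_forall_path {f : E → ℝ} (hf : Differentiable ℝ f)
    (hf' : Continuous (gradient f)) {ε c : ℝ} (hε : 0 < ε) (γ₀ : C(unitInterval, E))
    (h0 : f (γ₀ 0) < c) (h1 : f (γ₀ 1) < c)
    (hc : ∀ σ : C(unitInterval, E), σ 0 = γ₀ 0 → σ 1 = γ₀ 1 → c ≤ ⨆ s, f (σ s)) :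
    ∃ x, c ≤ f x ∧ f x ≤ ⨆ s, f (γ₀ s) ∧ ‖gradient f x‖ ≤ ε := by
  let P : Set C(unitInterval, E) := {σ | σ 0 = γ₀ 0 ∧ σ 1 = γ₀ 1}
  have hP : IsClosed P :=
    (isClosed_eq (continuous_eval_const 0) continuous_const).inter
      (isClosed_eq (continuous_eval_const 1) continuous_const)
  have : CompleteSpace P := hP.completeSpace_coe
  obtain ⟨⟨γ, hγ0, hγ1⟩, hle, hmin⟩ :=
    exists_le_forall_le_add_mul_dist (X := P) (Φ := fun σ => ⨆ s, f (σ.1 s))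
      ((lowerSemicontinuous_iSup_comp_continuousMap hf.continuous).comp continuous_subtype_val)
      ⟨c, by rintro _ ⟨σ, rfl⟩; exact hc σ.1 σ.2.1 σ.2.2⟩ hε ⟨γ₀, rfl, rfl⟩
  have hcγ := hc γ hγ0 hγ1
  obtain ⟨s, hs, hsε⟩ := exists_norm_gradient_le_of_iSup_le hf hf' hε γ
    (hγ0 ▸ h0.trans_le hcγ) (hγ1 ▸ h1.trans_le hcγ)
    fun σ hσ0 hσ1 => hmin ⟨σ, hσ0.trans hγ0, hσ1.trans hγ1⟩
  exact ⟨γ s, hs ▸ hcγ, hs ▸ hle, hsε⟩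

end UnitInterval

/-- **Mountain pass theorem.** Let `E` be a real Hilbert space and `f : E → ℝ` of class
`C^{1,1}`. If the sublevel set `{f < a}` is the union of two nonempty disjoint open sets `A` and
`B`, and `c` is the infimum over all continuous paths from `A` to `B` of the maximum of `f` along
the path, then `c ≥ a`, `f` admits a Palais–Smale sequence at level `c`, and if `f` satisfies the
Palais–Smale condition at level `c` then `c` is a critical value of `f`. -/
theorem mountain_pass_theorem
    {E : Type*} [NormedAddCommGroup E] [InnerProductSpace ℝ E] [CompleteSpace E]
    (f : E → ℝ) (hf : Differentiable ℝ f)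
    (hf' : LocallyLipschitz fun x => gradient f x)
    (a : ℝ) (A B : Set E) (hA : IsOpen A) (hB : IsOpen B)
    (hAne : A.Nonempty) (hBne : B.Nonempty) (hAB : Disjoint A B)
    (hsub : {x : E | f x < a} = A ∪ B)
    (c : ℝ)
    (hc : c = sInf {m : ℝ | ∃ γ : ℝ → E, ContinuousOn γ (Set.Icc 0 1) ∧
      γ 0 ∈ A ∧ γ 1 ∈ B ∧ IsGreatest (f '' (γ '' Set.Icc 0 1)) m}) :
    a ≤ c ∧
    (∃ u : ℕ → E,
      Tendsto (fun n => f (u n)) atTop (𝓝 c) ∧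
      Tendsto (fun n => ‖gradient f (u n)‖) atTop (𝓝 0)) ∧
    ((∀ u : ℕ → E,
        Tendsto (fun n => f (u n)) atTop (𝓝 c) →
        Tendsto (fun n => ‖gradient f (u n)‖) atTop (𝓝 0) →
        ∃ (y : E) (ψ : ℕ → ℕ), StrictMono ψ ∧ Tendsto (fun n => u (ψ n)) atTop (𝓝 y)) →
      ∃ x : E, f x = c ∧ gradient f x = 0) := by
  have hfc := hf.continuous
  have hgc : Continuous (gradient f) := hf'.continuous
  set S : Set ℝ := {m : ℝ | ∃ γ : ℝ → E, ContinuousOn γ (Set.Icc 0 1) ∧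
      γ 0 ∈ A ∧ γ 1 ∈ B ∧ IsGreatest (f '' (γ '' Set.Icc 0 1)) m} with hS
  have hS_le : ∀ m ∈ S, a ≤ m := by
    rintro m ⟨γ, hγ, hγ0, hγ1, -, hm⟩
    by_contra! hma
    have hpre : IsPreconnected (γ '' Set.Icc 0 1) := isPreconnected_Icc.image γ hγ
    have hsubset : γ '' Set.Icc 0 1 ⊆ A ∪ B := fun x hx =>
      hsub ▸ (hm (Set.mem_image_of_mem f hx)).trans_lt hma
    have h0 : γ 0 ∈ γ '' Set.Icc 0 1 := Set.mem_image_of_mem γ (by simp)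
    have h1 : γ 1 ∈ γ '' Set.Icc 0 1 := Set.mem_image_of_mem γ (by simp)
    rcases hpre.subset_or_subset hA hB hAB hsubset with h | h
    · exact Set.disjoint_left.1 hAB (h h1) hγ1
    · exact Set.disjoint_left.1 hAB hγ0 (h h0)
  have hS_mem : ∀ σ : C(unitInterval, E), σ 0 ∈ A → σ 1 ∈ B → (⨆ s, f (σ s)) ∈ S := by
    intro σ h0 h1
    have himage : Set.IccExtend zero_le_one σ '' Set.Icc 0 1 = Set.range σ := by
      rw [Set.image_eq_range]
      congr 1
      ext s
      simp
    refine ⟨Set.IccExtend zero_le_one σ, σ.continuous.Icc_extend'.continuousOn,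
      by simpa using h0, by simpa using h1, ?_⟩
    rw [himage, ← Set.range_comp]
    exact ⟨exists_eq_iSup_comp_continuousMap hfc σ, by
      rintro _ ⟨s, rfl⟩; exact le_ciSup (bddAbove_range_comp_continuousMap hfc σ) s⟩
  have hS_ne : S.Nonempty := by
    obtain ⟨p, hp⟩ := hAne
    obtain ⟨q, hq⟩ := hBne
    exact ⟨_, hS_mem ⟨fun s => AffineMap.lineMap p q (s : ℝ), by fun_prop⟩
      (by simpa using hp) (by simpa using hq)⟩
  have hac : a ≤ c := hc ▸ le_csInf hS_ne hS_le
  have hcS : ∀ m ∈ S, c ≤ m := fun m hm => hc ▸ csInf_le ⟨a, hS_le⟩ hm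
  have hlt : ∀ x ∈ A ∪ B, f x < c := fun x hx => by
    rw [← hsub] at hx
    exact lt_of_lt_of_le hx hac
  have hPS : ∀ ε : ℝ, 0 < ε → ∃ x, c ≤ f x ∧ f x ≤ c + ε ∧ ‖gradient f x‖ ≤ ε := by
    intro ε hε
    obtain ⟨m, ⟨γ, hγ, hγ0, hγ1, -, hm⟩, hmc⟩ :=
      exists_lt_of_csInf_lt hS_ne (hc.symm.trans_lt (lt_add_of_pos_right c hε))
    let γ₀ : C(unitInterval, E) := ⟨fun s => γ s, continuousOn_iff_continuous_domRestrict.1 hγ⟩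
    have h0 : γ₀ 0 ∈ A := hγ0
    have h1 : γ₀ 1 ∈ B := hγ1
    obtain ⟨x, hcx, hx, hxε⟩ := exists_norm_gradient_le_of_forall_path hf hgc hε γ₀
      (hlt _ (Or.inl h0)) (hlt _ (Or.inr h1))
      fun σ hσ0 hσ1 => hcS _ (hS_mem σ (hσ0 ▸ h0) (hσ1 ▸ h1))
    refine ⟨x, hcx, hx.trans ((ciSup_le fun s => ?_).trans hmc.le), hxε⟩
    exact hm (Set.mem_image_of_mem f (Set.mem_image_of_mem γ s.2))
  choose u hu_ge hu_le hu_grad using fun n : ℕ =>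
    hPS (1 / ((n : ℝ) + 1)) Nat.one_div_pos_of_nat
  have hlim := tendsto_one_div_add_atTop_nhds_zero_nat (𝕜 := ℝ)
  have hu : Tendsto (fun n => f (u n)) atTop (𝓝 c) :=
    tendsto_of_tendsto_of_tendsto_of_le_of_le tendsto_const_nhds
      (by simpa using hlim.const_add c) hu_ge hu_le
  have hu' : Tendsto (fun n => ‖gradient f (u n)‖) atTop (𝓝 0) :=
    squeeze_zero (fun _ => norm_nonneg _) hu_grad hlim
  refine ⟨hac, ⟨u, hu, hu'⟩, fun hcomp => ?_⟩
  obtain ⟨y, ψ, hψ, hy⟩ := hcomp u hu hu'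
  refine ⟨y, tendsto_nhds_unique ((hfc.tendsto y).comp hy) (hu.comp hψ.tendsto_atTop), ?_⟩
  exact norm_eq_zero.1 <| tendsto_nhds_unique ((hgc.norm.tendsto y).comp hy)
    (hu'.comp hψ.tendsto_atTop)
end

section
/- Variation of a locally exact 1-form under homotopies fixing the initial point: Let E be a real normed vector space, U ⊆ E open, and ω a continuous, locally exact 1-form on U. Let R > 0 and let u : ℝ × ℝ → E be a C¹ map sending [0,R] × [0,1] into U; write u_r := u(r,·) and u^s := u(·,s). For a C¹ path γ : [0,1] → U and s ∈ [0,1] set ΔS(γ)(s) := ∫₀^s ω(γ(t))[γ'(t)] dt. If the path u^0 = u(·,0) is constant, then for every s ∈ [0,1]: ∫₀^s ω(u(R,t))[∂_t u(R,t)] dt = ∫₀^s ω(u(0,t))[∂_t u(0,t)] dt + ∫₀^R ω(u(r,s))[∂_r u(r,s)] dr, i.e. ΔS(u_R)(s) = ΔS(u_0)(s) + ΔS(u^s)(R). -/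
open Set intervalIntegral
open Topology MeasureTheory Filter

/-- The integral of the 1-form `f dr + g dt` around the boundary of a rectangle vanishes
as soon as it does so for all small rectangles. -/
theorem integral_boundary_rect_eq_of_locally_eq {f g : ℝ → ℝ → ℝ} {I J : Set ℝ}
    (hI : IsPreconnected I) (hJ : IsPreconnected J)
    (hf : ∀ t ∈ J, ∀ a ∈ I, ∀ b ∈ I, IntervalIntegrable (fun r => f r t) volume a b)
    (hg : ∀ r ∈ I, ∀ c ∈ J, ∀ d ∈ J, IntervalIntegrable (fun t => g r t) volume c d)
    (hloc : ∀ r₀ ∈ I, ∀ t₀ ∈ J, ∃ A ∈ 𝓝[I] r₀, ∃ B ∈ 𝓝[J] t₀, ∀ a ∈ A, ∀ b ∈ A,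
      ∀ c ∈ B, ∀ d ∈ B,
      (∫ r in a..b, f r c) + (∫ t in c..d, g b t) = (∫ t in c..d, g a t) + ∫ r in a..b, f r d)
    {a b c d : ℝ} (ha : a ∈ I) (hb : b ∈ I) (hc : c ∈ J) (hd : d ∈ J) :
    (∫ r in a..b, f r c) + (∫ t in c..d, g b t) =
      (∫ t in c..d, g a t) + ∫ r in a..b, f r d := by
  have strip : ∀ t₀ ∈ J, ∃ B ∈ 𝓝[J] t₀, ∀ c ∈ B, ∀ d ∈ B,
      (∫ r in a..b, f r c) + (∫ t in c..d, g b t) =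
        (∫ t in c..d, g a t) + ∫ r in a..b, f r d := by
    intro t₀ ht₀
    refine hI.induction₂ (fun a b => ∃ B ∈ 𝓝[J] t₀, ∀ c ∈ B, ∀ d ∈ B,
      (∫ r in a..b, f r c) + (∫ t in c..d, g b t) =
        (∫ t in c..d, g a t) + ∫ r in a..b, f r d) ?_ ?_ ?_ ha hb
    · intro r₀ hr₀
      obtain ⟨A, hA, B, hB, h⟩ := hloc r₀ hr₀ t₀ ht₀
      filter_upwards [hA] with r hr
      exact ⟨B, hB, h r₀ (mem_of_mem_nhdsWithin hr₀ hA) r hr⟩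
    · rintro x y z hx hy hz ⟨B, hB, h⟩ ⟨B', hB', h'⟩
      refine ⟨B ∩ B' ∩ J, inter_mem (inter_mem hB hB') self_mem_nhdsWithin, ?_⟩
      rintro c ⟨⟨hc, hc'⟩, hcJ⟩ d ⟨⟨hd, hd'⟩, hdJ⟩
      rw [← integral_add_adjacent_intervals (hf c hcJ x hx y hy) (hf c hcJ y hy z hz),
        ← integral_add_adjacent_intervals (hf d hdJ x hx y hy) (hf d hdJ y hy z hz)]
      linarith [h c hc d hd, h' c hc' d hd']
    · rintro x y hx hy ⟨B, hB, h⟩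
      refine ⟨B, hB, fun c hc d hd => ?_⟩
      rw [integral_symm x y, integral_symm x y]
      linarith [h c hc d hd]
  refine hJ.induction₂ (fun c d => (∫ r in a..b, f r c) + (∫ t in c..d, g b t) =
      (∫ t in c..d, g a t) + ∫ r in a..b, f r d) ?_ ?_ ?_ hc hd
  · intro t₀ ht₀
    obtain ⟨B, hB, h⟩ := strip t₀ ht₀
    filter_upwards [hB] with t ht
    exact h t₀ (mem_of_mem_nhdsWithin ht₀ hB) t ht
  · intro x y z hx hy hz h h'
    rw [← integral_add_adjacent_intervals (hg a ha x hx y hy) (hg a ha y hy z hz),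
      ← integral_add_adjacent_intervals (hg b hb x hx y hy) (hg b hb y hy z hz)]
    linarith
  · intro x y hx hy h
    rw [integral_symm x y, integral_symm x y]
    linarith

section PathIntegral

variable {E : Type*} [NormedAddCommGroup E] [NormedSpace ℝ E] {ω : E → (E →L[ℝ] ℝ)}
  {γ : ℝ → E} {a b : ℝ}

/-- A continuous 1-form is integrable along a `C¹` path. -/
theorem intervalIntegrable_oneForm_deriv {U : Set E} (hω : ContinuousOn ω U)
    (hγ : ContDiff ℝ 1 γ) (h : MapsTo γ (uIcc a b) U) :
    IntervalIntegrable (fun t => ω (γ t) (deriv γ t)) volume a b :=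
  ((hω.comp hγ.continuous.continuousOn h).clm_apply
    hγ.continuous_deriv_one.continuousOn).intervalIntegrable

/-- The integral of `dS` along a `C¹` path is the increment of `S`. -/
theorem integral_oneForm_deriv_eq_sub {V : Set E} (hω : ContinuousOn ω V) {S : E → ℝ}
    (hS : ∀ y ∈ V, HasFDerivAt S (ω y) y) (hγ : ContDiff ℝ 1 γ) (h : MapsTo γ (uIcc a b) V) :
    ∫ t in a..b, ω (γ t) (deriv γ t) = S (γ b) - S (γ a) :=
  integral_eq_sub_of_hasDerivAt
    (fun t ht => (hS _ (h ht)).comp_hasDerivAt t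
      ((hγ.differentiable one_ne_zero) t).hasDerivAt)
    (intervalIntegrable_oneForm_deriv hω hγ h)

/-- The integral of a 1-form along a constant path is zero. -/
theorem integral_oneForm_deriv_eq_zero_of_const (hab : a < b) (hγ : Differentiable ℝ γ)
    (h : ∀ x ∈ Icc a b, ∀ y ∈ Icc a b, γ x = γ y) :
    ∫ t in a..b, ω (γ t) (deriv γ t) = 0 := by
  refine (integral_congr (g := fun _ => (0 : ℝ)) fun t ht => ?_).trans (by simp)
  rw [uIcc_of_le hab.le] at ht
  have : deriv γ t = 0 := (uniqueDiffOn_Icc hab t ht).eq_deriv _ (hγ t).hasDerivAt.hasDerivWithinAt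
    ((hasDerivWithinAt_const t _ (γ t)).congr (fun x hx => h x hx t ht) rfl)
  simp [this]

end PathIntegral

/-- **Variation of a locally exact 1-form under homotopies fixing the initial point.**
Let `ω` be a continuous, locally exact 1-form on an open set `U` of a real normed space `E`,
and let `u : ℝ × ℝ → E` be a `C¹` map sending `[0,R] × [0,1]` into `U` such that the path
`r ↦ u(r,0)` is constant on `[0,R]`. Then for every `s ∈ [0,1]`,
`ΔS(u_R)(s) = ΔS(u_0)(s) + ΔS(u^s)(R)`, where `ΔS(γ)(s) = ∫₀^s ω(γ(t))[γ'(t)] dt`. -/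
theorem variation_of_locally_exact_one_form
    {E : Type*} [NormedAddCommGroup E] [NormedSpace ℝ E]
    (U : Set E) (hU : IsOpen U)
    (ω : E → (E →L[ℝ] ℝ)) (hω : ContinuousOn ω U)
    (hloc : ∀ x ∈ U, ∃ V : Set E, IsOpen V ∧ x ∈ V ∧ V ⊆ U ∧
      ∃ S : E → ℝ, ∀ y ∈ V, HasFDerivAt S (ω y) y)
    (R : ℝ) (hR : 0 < R)
    (u : ℝ × ℝ → E) (hu : ContDiff ℝ 1 u)
    (hmaps : Set.MapsTo u (Set.Icc 0 R ×ˢ Set.Icc 0 1) U)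
    (hconst : ∀ r₁ ∈ Set.Icc (0:ℝ) R, ∀ r₂ ∈ Set.Icc (0:ℝ) R, u (r₁, 0) = u (r₂, 0)) :
    ∀ s ∈ Set.Icc (0:ℝ) 1,
      (∫ t in (0:ℝ)..s, ω (u (R, t)) (deriv (fun t' => u (R, t')) t)) =
      (∫ t in (0:ℝ)..s, ω (u (0, t)) (deriv (fun t' => u (0, t')) t)) +
      ∫ r in (0:ℝ)..R, ω (u (r, s)) (deriv (fun r' => u (r', s)) r) := by
  intro s hs
  have hr : ∀ t, ContDiff ℝ 1 fun r => u (r, t) := fun t => by fun_prop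
  have ht : ∀ r, ContDiff ℝ 1 fun t => u (r, t) := fun r => by fun_prop
  have key := integral_boundary_rect_eq_of_locally_eq
    (f := fun r t => ω (u (r, t)) (deriv (fun r' => u (r', t)) r))
    (g := fun r t => ω (u (r, t)) (deriv (fun t' => u (r, t')) t))
    (isPreconnected_Icc (a := (0 : ℝ)) (b := R)) (isPreconnected_Icc (a := (0 : ℝ)) (b := 1))
    (fun t htJ a ha b hb => intervalIntegrable_oneForm_deriv hω (hr t)
      fun r hrI => hmaps ⟨ordConnected_Icc.uIcc_subset ha hb hrI, htJ⟩)
    (fun r hrI c hc d hd => intervalIntegrable_oneForm_deriv hω (ht r)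
      fun t htJ => hmaps ⟨hrI, ordConnected_Icc.uIcc_subset hc hd htJ⟩)
    ?_ (left_mem_Icc.2 hR.le) (right_mem_Icc.2 hR.le) (left_mem_Icc.2 zero_le_one) hs
  · rwa [integral_oneForm_deriv_eq_zero_of_const hR ((hr 0).differentiable one_ne_zero) hconst,
      zero_add] at key
  intro r₀ hr₀ t₀ ht₀
  obtain ⟨V, hV, hxV, hVU, S, hS⟩ := hloc _ (hmaps (mk_mem_prod hr₀ ht₀))
  obtain ⟨ε, hε, hball⟩ := Metric.isOpen_iff.1 (hV.preimage hu.continuous) (r₀, t₀) hxV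
  rw [← ball_prod_same] at hball
  refine ⟨_, mem_nhdsWithin_of_mem_nhds (Metric.ball_mem_nhds r₀ hε),
    _, mem_nhdsWithin_of_mem_nhds (Metric.ball_mem_nhds t₀ hε), fun a ha b hb c hc d hd => ?_⟩
  have hoc : ∀ x : ℝ, (Metric.ball x ε).OrdConnected := fun x => (convex_ball x ε).ordConnected
  have hI : ∀ t ∈ Metric.ball t₀ ε, ∫ r in a..b, ω (u (r, t)) (deriv (fun r' => u (r', t)) r) =
      S (u (b, t)) - S (u (a, t)) := fun t htB =>
    integral_oneForm_deriv_eq_sub (hω.mono hVU) hS (hr t)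
      fun r hrA => hball ⟨(hoc r₀).uIcc_subset ha hb hrA, htB⟩
  have hJ : ∀ r ∈ Metric.ball r₀ ε, ∫ t in c..d, ω (u (r, t)) (deriv (fun t' => u (r, t')) t) =
      S (u (r, d)) - S (u (r, c)) := fun r hrA =>
    integral_oneForm_deriv_eq_sub (hω.mono hVU) hS (ht r)
      fun t htB => hball ⟨hrA, (hoc t₀).uIcc_subset hc hd htB⟩
  rw [hI c hc, hI d hd, hJ a ha, hJ b hb]
  ring
end

section
/- Free-homotopy invariance of integrals of locally exact 1-forms along loops: Let E be a real normed vector space, U ⊆ E open, and ω a continuous, locally exact 1-form on U. Let h : ℝ × ℝ → E be a C¹ map sending [0,1] × [0,1] into U and satisfying h(r,0) = h(r,1) for every r ∈ [0,1] (so that each t ↦ h(r,t) is a loop, and h is a free homotopy of loops). Then ∫₀¹ ω(h(0,t))[∂_t h(0,t)] dt = ∫₀¹ ω(h(1,t))[∂_t h(1,t)] dt; that is, the integral of ω over a closed C¹ loop depends only on the free-homotopy class of the loop. -/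
open Set intervalIntegral

section LocallyExact

variable {E : Type*} [NormedAddCommGroup E] [NormedSpace ℝ E]

/-- The pullback of a continuous 1-form along a `C¹` path is interval integrable. -/
lemma intervalIntegrable_one_form_comp_deriv {U : Set E} {ω : E → (E →L[ℝ] ℝ)}
    (hω : ContinuousOn ω U) {γ : ℝ → E} (hγ : ContDiff ℝ 1 γ) {a b : ℝ}
    (hmaps : MapsTo γ (uIcc a b) U) :
    IntervalIntegrable (fun t => ω (γ t) (deriv γ t)) MeasureTheory.volume a b :=
  ((hω.comp hγ.continuous.continuousOn hmaps).clm_apply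
    (hγ.continuous_deriv le_rfl).continuousOn).intervalIntegrable

/-- The integral of a 1-form along a `C¹` path inside the domain of a primitive `S`
is the increment of `S`. -/
lemma integral_one_form_eq_sub_of_primitive {V : Set E} {ω : E → (E →L[ℝ] ℝ)}
    (hω : ContinuousOn ω V) {S : E → ℝ} (hS : ∀ y ∈ V, HasFDerivAt S (ω y) y)
    {γ : ℝ → E} (hγ : ContDiff ℝ 1 γ) {a b : ℝ} (hmaps : MapsTo γ (uIcc a b) V) :
    ∫ t in a..b, ω (γ t) (deriv γ t) = S (γ b) - S (γ a) :=
  integral_eq_sub_of_hasDerivAt (f := S ∘ γ)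
    (fun t ht => (hS _ (hmaps ht)).comp_hasDerivAt t
      (hγ.differentiable one_ne_zero t).hasDerivAt)
    (intervalIntegrable_one_form_comp_deriv hω hγ hmaps)

/-- On a rectangle mapped into the domain of a primitive, the difference of the integrals along
the two sides `r = r₀`, `r = r₁` equals the difference along the sides `t = a`, `t = b`. -/
lemma integral_one_form_rectangle_of_primitive {V : Set E} {ω : E → (E →L[ℝ] ℝ)}
    (hω : ContinuousOn ω V) {S : E → ℝ} (hS : ∀ y ∈ V, HasFDerivAt S (ω y) y)
    {h : ℝ × ℝ → E} (hh : ContDiff ℝ 1 h) {r₀ r₁ a b : ℝ}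
    (hmaps : MapsTo h (uIcc r₀ r₁ ×ˢ uIcc a b) V) :
    (∫ t in a..b, ω (h (r₁, t)) (deriv (fun t' => h (r₁, t')) t)) -
      (∫ t in a..b, ω (h (r₀, t)) (deriv (fun t' => h (r₀, t')) t)) =
    (∫ r in r₀..r₁, ω (h (r, b)) (deriv (fun r' => h (r', b)) r)) -
      ∫ r in r₀..r₁, ω (h (r, a)) (deriv (fun r' => h (r', a)) r) := by
  have ht (r : ℝ) (hr : r ∈ uIcc r₀ r₁) :=
    integral_one_form_eq_sub_of_primitive hω hS (γ := fun t => h (r, t))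
      (hh.comp (contDiff_const.prodMk contDiff_id)) (fun t (ht : t ∈ uIcc a b) => hmaps ⟨hr, ht⟩)
  have hr (t : ℝ) (ht : t ∈ uIcc a b) :=
    integral_one_form_eq_sub_of_primitive hω hS (γ := fun r => h (r, t))
      (hh.comp (contDiff_id.prodMk contDiff_const)) (fun r (hr : r ∈ uIcc r₀ r₁) => hmaps ⟨hr, ht⟩)
  rw [ht r₁ right_mem_uIcc, ht r₀ left_mem_uIcc, hr b right_mem_uIcc, hr a left_mem_uIcc]
  ring

/-- A `C¹` map of the unit square into the domain of a locally exact form admits a uniform grid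
each of whose cells is mapped into the domain of a local primitive. -/
lemma exists_grid_primitive {U : Set E} {ω : E → (E →L[ℝ] ℝ)}
    (hloc : ∀ x ∈ U, ∃ V : Set E, IsOpen V ∧ x ∈ V ∧ V ⊆ U ∧
      ∃ S : E → ℝ, ∀ y ∈ V, HasFDerivAt S (ω y) y)
    {h : ℝ × ℝ → E} (hh : Continuous h) (hmaps : MapsTo h (Icc 0 1 ×ˢ Icc 0 1) U) :
    ∃ N : ℕ, 0 < N ∧ ∀ i < N, ∀ j < N, ∃ V ⊆ U, ∃ S : E → ℝ,
      (∀ y ∈ V, HasFDerivAt S (ω y) y) ∧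
      MapsTo h (uIcc ((i : ℝ) / N) ((i + 1 : ℕ) / N) ×ˢ
        uIcc ((j : ℝ) / N) ((j + 1 : ℕ) / N)) V := by
  choose V hVo hxV hVU S hS using hloc
  obtain ⟨δ, hδ, hball⟩ := lebesgue_number_lemma_of_metric
    (isCompact_Icc.prod isCompact_Icc : IsCompact (Icc (0 : ℝ) 1 ×ˢ Icc (0 : ℝ) 1))
    (c := fun x : U => h ⁻¹' V x x.2) (fun x => (hVo x x.2).preimage hh)
    (fun p hp => mem_iUnion.2 ⟨⟨h p, hmaps hp⟩, hxV _ _⟩)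
  obtain ⟨n, hn⟩ := exists_nat_one_div_lt hδ
  refine ⟨n + 1, n.succ_pos, fun i hi j hj => ?_⟩
  have hpos : (0 : ℝ) < (n + 1 : ℕ) := by positivity
  have hcell {k : ℕ} : ∀ s ∈ uIcc ((k : ℝ) / (n + 1 : ℕ)) ((k + 1 : ℕ) / (n + 1 : ℕ)),
      dist s ((k : ℝ) / (n + 1 : ℕ)) < δ := by
    intro s hs
    refine (Real.dist_left_le_of_mem_uIcc hs |> (dist_comm _ _).trans_le).trans_lt ?_
    rw [Real.dist_eq, abs_sub_comm, ← sub_div, abs_of_nonneg (by push_cast; ring_nf; positivity)]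
    push_cast at hn ⊢
    simpa using hn
  have hmem {k : ℕ} (hk : k < n + 1) : (k : ℝ) / (n + 1 : ℕ) ∈ Icc (0 : ℝ) 1 :=
    ⟨by positivity, (div_le_one hpos).2 (by exact_mod_cast hk.le)⟩
  obtain ⟨x, hx⟩ := hball (i / (n + 1 : ℕ), j / (n + 1 : ℕ)) ⟨hmem hi, hmem hj⟩
  exact ⟨V x x.2, hVU _ _, S x x.2, hS _ _, fun p hp =>
    hx (max_lt (hcell _ hp.1) (hcell _ hp.2))⟩

/-- The integrals along two paths that agree on an interval are equal. -/
lemma integral_one_form_congr_path {ω : E → (E →L[ℝ] ℝ)} {γ₁ γ₂ : ℝ → E} {a b : ℝ} (hab : a ≤ b)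
    (hγ : EqOn γ₁ γ₂ (Icc a b)) :
    ∫ t in a..b, ω (γ₁ t) (deriv γ₁ t) = ∫ t in a..b, ω (γ₂ t) (deriv γ₂ t) := by
  rw [integral_of_le hab, integral_of_le hab, MeasureTheory.integral_Ioc_eq_integral_Ioo,
    MeasureTheory.integral_Ioc_eq_integral_Ioo]
  refine MeasureTheory.setIntegral_congr_fun measurableSet_Ioo fun t ht => ?_
  have heq : γ₁ =ᶠ[nhds t] γ₂ :=
    Filter.eventuallyEq_of_mem (Icc_mem_nhds ht.1 ht.2) hγ
  simp only [heq.deriv_eq, heq.eq_of_nhds]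

end LocallyExact

/-- **Free-homotopy invariance of integrals of locally exact 1-forms along loops.**
Let `ω` be a continuous, locally exact 1-form on an open set `U` of a real normed space `E`,
and let `h : ℝ × ℝ → E` be a `C¹` map sending `[0,1] × [0,1]` into `U` with `h(r,0) = h(r,1)`
for every `r ∈ [0,1]` (a free homotopy of `C¹` loops). Then the integral of `ω` along the
loop `t ↦ h(0,t)` equals the integral of `ω` along the loop `t ↦ h(1,t)`. -/
theorem integral_locally_exact_one_form_free_homotopy_invariant
    {E : Type*} [NormedAddCommGroup E] [NormedSpace ℝ E]
    (U : Set E) (hU : IsOpen U)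
    (ω : E → (E →L[ℝ] ℝ)) (hω : ContinuousOn ω U)
    (hloc : ∀ x ∈ U, ∃ V : Set E, IsOpen V ∧ x ∈ V ∧ V ⊆ U ∧
      ∃ S : E → ℝ, ∀ y ∈ V, HasFDerivAt S (ω y) y)
    (h : ℝ × ℝ → E) (hh : ContDiff ℝ 1 h)
    (hmaps : Set.MapsTo h (Set.Icc 0 1 ×ˢ Set.Icc 0 1) U)
    (hloop : ∀ r ∈ Set.Icc (0:ℝ) 1, h (r, 0) = h (r, 1)) :
    (∫ t in (0:ℝ)..1, ω (h (0, t)) (deriv (fun t' => h (0, t')) t)) =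
    ∫ t in (0:ℝ)..1, ω (h (1, t)) (deriv (fun t' => h (1, t')) t) := by
  obtain ⟨N, hN, hcell⟩ := exists_grid_primitive hloc hh.continuous hmaps
  have hpos : (0 : ℝ) < N := by exact_mod_cast hN
  have hmem {k : ℕ} (hk : k ≤ N) : (k : ℝ) / N ∈ Icc (0 : ℝ) 1 :=
    ⟨by positivity, (div_le_one hpos).2 (by exact_mod_cast hk)⟩
  have hstep : ∀ i ∈ Finset.range N,
      (∫ t in (0:ℝ)..1, ω (h (((i + 1 : ℕ) : ℝ) / N, t))
        (deriv (fun t' => h (((i + 1 : ℕ) : ℝ) / N, t')) t)) -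
      (∫ t in (0:ℝ)..1, ω (h ((i : ℝ) / N, t)) (deriv (fun t' => h ((i : ℝ) / N, t')) t)) = 0 := by
    intro i hi
    rw [Finset.mem_range] at hi
    have hsum {r : ℝ} (hr : r ∈ Icc (0 : ℝ) 1) :
        ∑ j ∈ Finset.range N, (∫ t in ((j : ℝ) / N)..((j + 1 : ℕ) / N),
          ω (h (r, t)) (deriv (fun t' => h (r, t')) t)) =
        ∫ t in (0:ℝ)..1, ω (h (r, t)) (deriv (fun t' => h (r, t')) t) := by
      rw [sum_integral_adjacent_intervals (a := fun j : ℕ => (j : ℝ) / N)]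
      · simp [hpos.ne']
      · intro j hj
        exact intervalIntegrable_one_form_comp_deriv hω (γ := fun t => h (r, t))
          (hh.comp (contDiff_const.prodMk contDiff_id))
          fun t ht => hmaps ⟨hr, uIcc_subset_Icc (hmem hj.le) (hmem hj) ht⟩
    rw [← hsum (hmem hi), ← hsum (hmem hi.le), ← Finset.sum_sub_distrib]
    have hrect : ∀ j ∈ Finset.range N, _ := fun j hj =>
      let ⟨_, hVU, _, hS, hm⟩ := hcell i hi j (Finset.mem_range.1 hj)
      integral_one_form_rectangle_of_primitive (hω.mono hVU) hS hh hm
    rw [Finset.sum_congr rfl hrect, Finset.sum_range_sub (fun j : ℕ =>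
      ∫ r in ((i : ℝ) / N)..((i + 1 : ℕ) / N),
        ω (h (r, (j : ℝ) / N)) (deriv (fun r' => h (r', (j : ℝ) / N)) r)), sub_eq_zero,
      div_self hpos.ne', Nat.cast_zero, zero_div]
    refine (integral_one_form_congr_path (γ₁ := fun r => h (r, 0)) (γ₂ := fun r => h (r, 1))
      (by gcongr; exact i.le_succ) fun r hr => hloop r ?_).symm
    exact Icc_subset_Icc (hmem hi.le).1 (hmem hi).2 hr
  have htotal := Finset.sum_eq_zero hstep
  rw [Finset.sum_range_sub (fun i : ℕ =>
    ∫ t in (0:ℝ)..1, ω (h ((i : ℝ) / N, t)) (deriv (fun t' => h ((i : ℝ) / N, t')) t)),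
    sub_eq_zero, div_self hpos.ne', Nat.cast_zero, zero_div] at htotal
  exact htotal.symm
end

section
/- Distance estimate along flow lines of the normalized negative gradient: Let E be a real Hilbert space with inner product ⟨·,·⟩, let V : E → E be continuous, let R > 0, and let u : ℝ → E be a curve that is differentiable at every r ∈ [0,R] with derivative u'(r) = −V(u(r))/√(1 + ‖V(u(r))‖²). Then −∫₀^R ⟨V(u(r)), u'(r)⟩ dr ≥ ‖u(R) − u(0)‖² / R. -/
open scoped RealInnerProductSpace

/-- Completing the square: the tangent-line bound for `‖·‖ ^ 2` at `c`. -/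
lemma two_mul_inner_sub_norm_sq_le {E : Type*} [NormedAddCommGroup E] [InnerProductSpace ℝ E]
    (c w : E) : 2 * ⟪c, w⟫ - ‖c‖ ^ 2 ≤ ‖w‖ ^ 2 := by
  have h := norm_sub_sq_real c w
  nlinarith [sq_nonneg ‖c - w‖]

/-- The normalized vector `v / √(1 + ‖v‖²)` satisfies `‖v / √(1 + ‖v‖²)‖² ≤ ⟨v, v / √(1 + ‖v‖²)⟩`. -/
lemma norm_sq_neg_normalized_le {E : Type*} [NormedAddCommGroup E] [InnerProductSpace ℝ E]
    (v : E) :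
    ‖-((Real.sqrt (1 + ‖v‖ ^ 2))⁻¹ • v)‖ ^ 2 ≤
      -⟪v, -((Real.sqrt (1 + ‖v‖ ^ 2))⁻¹ • v)⟫ := by
  have h_one : 1 ≤ Real.sqrt (1 + ‖v‖ ^ 2) := by
    rw [Real.one_le_sqrt]
    nlinarith [sq_nonneg ‖v‖]
  have h_inv : (Real.sqrt (1 + ‖v‖ ^ 2))⁻¹ ≤ 1 := inv_le_one_of_one_le₀ h_one
  have h_nonneg : 0 ≤ (Real.sqrt (1 + ‖v‖ ^ 2))⁻¹ := by positivity
  rw [norm_neg, norm_smul, Real.norm_of_nonneg h_nonneg, inner_neg_right, neg_neg,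
    real_inner_smul_right, real_inner_self_eq_norm_sq, mul_pow]
  gcongr
  nlinarith

/-- **Distance estimate along flow lines of the normalized negative gradient.**
Let `E` be a real Hilbert space, `V : E → E` continuous, `R > 0`, and `u : ℝ → E` a curve with
`u'(r) = −V(u(r))/√(1 + ‖V(u(r))‖²)` for every `r ∈ [0,R]`. Then
`−∫₀^R ⟨V(u(r)), u'(r)⟩ dr ≥ ‖u(R) − u(0)‖² / R`. -/
theorem dist_sq_le_neg_integral_along_normalized_gradient_flow
    {E : Type*} [NormedAddCommGroup E] [InnerProductSpace ℝ E] [CompleteSpace E]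
    (V : E → E) (hV : Continuous V)
    (R : ℝ) (hR : 0 < R)
    (u : ℝ → E)
    (hu : ∀ r ∈ Set.Icc (0:ℝ) R,
      HasDerivAt u (-((Real.sqrt (1 + ‖V (u r)‖ ^ 2))⁻¹ • V (u r))) r) :
    ‖u R - u 0‖ ^ 2 / R ≤ -∫ r in (0:ℝ)..R, ⟪V (u r), deriv u r⟫ := by
  set w : ℝ → E := fun r => -((Real.sqrt (1 + ‖V (u r)‖ ^ 2))⁻¹ • V (u r)) with hw
  set c : E := u R - u 0 with hc
  have h_cont_u : ContinuousOn u (Set.Icc 0 R) := fun r hr =>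
    (hu r hr).continuousAt.continuousWithinAt
  have h_cont_V : ContinuousOn (fun r => V (u r)) (Set.Icc 0 R) := hV.comp_continuousOn h_cont_u
  have h_cont_w : ContinuousOn w (Set.Icc 0 R) := by
    refine ((ContinuousOn.inv₀ (by fun_prop) fun r _ => ?_).smul h_cont_V).neg
    positivity
  have h_Icc : Set.uIcc 0 R = Set.Icc 0 R := Set.uIcc_of_le hR.le
  have h_int_w : IntervalIntegrable w MeasureTheory.volume 0 R :=
    ContinuousOn.intervalIntegrable (by rwa [h_Icc])
  have h_int_inner : IntervalIntegrable (fun r => ⟪c, w r⟫) MeasureTheory.volume 0 R :=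
    ContinuousOn.intervalIntegrable (by rw [h_Icc]; fun_prop)
  have h_int_energy : IntervalIntegrable (fun r => -⟪V (u r), w r⟫) MeasureTheory.volume 0 R :=
    ContinuousOn.intervalIntegrable (by rw [h_Icc]; exact (h_cont_V.inner h_cont_w).neg)
  have h_ftc : ∫ r in (0:ℝ)..R, ⟪c, w r⟫ = ‖c‖ ^ 2 := by
    have h_deriv : ∀ r ∈ Set.uIcc 0 R, HasDerivAt (fun t => ⟪c, u t⟫) ⟪c, w r⟫ r := by
      intro r hr
      rw [h_Icc] at hr
      simpa [hw] using (hasDerivAt_const r c).inner ℝ (hu r hr)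
    rw [intervalIntegral.integral_eq_sub_of_hasDerivAt h_deriv h_int_inner, ← inner_sub_right,
      ← hc, real_inner_self_eq_norm_sq]
  have h_congr : ∫ r in (0:ℝ)..R, ⟪V (u r), deriv u r⟫ = ∫ r in (0:ℝ)..R, ⟪V (u r), w r⟫ := by
    refine intervalIntegral.integral_congr fun r hr => ?_
    rw [h_Icc] at hr
    simp only [(hu r hr).deriv, hw]
  have h_pointwise : ∀ r ∈ Set.Icc 0 R,
      2 / R * ⟪c, w r⟫ - ‖c‖ ^ 2 / R ^ 2 ≤ -⟪V (u r), w r⟫ := by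
    intro r _
    refine le_trans ?_ (norm_sq_neg_normalized_le (V (u r)))
    refine le_trans (le_of_eq ?_) (two_mul_inner_sub_norm_sq_le (R⁻¹ • c) (w r))
    rw [real_inner_smul_left, norm_smul, Real.norm_of_nonneg (by positivity)]
    field_simp
  have h_mono := intervalIntegral.integral_mono_on hR.le
    ((h_int_inner.const_mul (2 / R)).sub intervalIntegrable_const) h_int_energy h_pointwise
  rw [intervalIntegral.integral_sub (h_int_inner.const_mul (2 / R)) intervalIntegrable_const,
    intervalIntegral.integral_const_mul, h_ftc, intervalIntegral.integral_const,
    intervalIntegral.integral_neg, ← h_congr] at h_mono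
  refine le_trans (le_of_eq ?_) h_mono
  rw [smul_eq_mul]
  field_simp
  ring
end

section
/- Lower bound for the free-time action in terms of length (mountain-pass geometry estimate): Let n ≥ 1, a > 0, and let L : ℝⁿ × ℝⁿ → ℝ be of class C² such that for all q, v, u ∈ ℝⁿ the second derivative in the fiber variable satisfies D²_{vv}L(q,v)[u,u] ≥ 2a‖u‖². For q ∈ ℝⁿ let θ_q := d_v L(q,0) (the differential at 0 of v ↦ L(q,v)) and recall that the energy at zero velocity is E(q,0) = −L(q,0). Let U ⊆ ℝⁿ and c_E, c_θ ∈ ℝ be such that −L(q,0) ≤ c_E and ‖θ_q‖ ≤ c_θ for every q ∈ U. Let k ∈ ℝ, T > 0, and let γ : [0,T] → ℝⁿ be a C¹ curve with image contained in U; set A_k(γ) := ∫₀^T ( L(γ(t), γ'(t)) + k ) dt and l(γ) := ∫₀^T ‖γ'(t)‖ dt. Then A_k(γ) ≥ (k − c_E)·T + (a/T)·l(γ)² − c_θ·l(γ). Consequently, if k ≥ c_E and 2√(a(k − c_E)) ≥ c_θ, then A_k(γ) ≥ (2√(a(k − c_E)) − c_θ)·l(γ) ≥ 0. -/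
open Set

/-- A `C²` function whose second derivative is bounded below by `2a‖·‖²` lies above its
tangent plane at the origin by at least `a‖v‖²`. -/
theorem add_fderiv_add_mul_norm_sq_le {E : Type*} [NormedAddCommGroup E] [NormedSpace ℝ E]
    {f : E → ℝ} (hf : ContDiff ℝ 2 f) {a : ℝ}
    (hconv : ∀ v u : E, 2 * a * ‖u‖ ^ 2 ≤ iteratedFDeriv ℝ 2 f v ![u, u]) (v : E) :
    f 0 + fderiv ℝ f 0 v + a * ‖v‖ ^ 2 ≤ f v := by
  have hline (t : ℝ) : HasDerivAt (fun t : ℝ => t • v) v t := by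
    simpa using (hasDerivAt_id t).smul_const v
  have hdf : Differentiable ℝ f := hf.differentiable (by norm_num)
  have hddf : Differentiable ℝ (fderiv ℝ f) :=
    (hf.fderiv_right (m := 1) (by norm_num)).differentiable (by norm_num)
  have h1 (t : ℝ) : HasDerivAt (fun t : ℝ => f (t • v)) (fderiv ℝ f (t • v) v) t :=
    (hdf (t • v)).hasFDerivAt.comp_hasDerivAt t (hline t)
  have h2 (t : ℝ) : HasDerivAt (fun t : ℝ => fderiv ℝ f (t • v) v)
      (fderiv ℝ (fderiv ℝ f) (t • v) v v) t := by
    have hcurve : HasDerivAt (fun t : ℝ => fderiv ℝ f (t • v))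
        (fderiv ℝ (fderiv ℝ f) (t • v) v) t :=
      (hddf (t • v)).hasFDerivAt.comp_hasDerivAt t (hline t)
    exact (ContinuousLinearMap.apply ℝ ℝ v).hasFDerivAt.comp_hasDerivAt t hcurve
  have hslope (t : ℝ) : HasDerivAt
      (fun t : ℝ => fderiv ℝ f (t • v) v - 2 * a * ‖v‖ ^ 2 * t)
      (fderiv ℝ (fderiv ℝ f) (t • v) v v - 2 * a * ‖v‖ ^ 2) t := by
    simpa using (h2 t).fun_sub ((hasDerivAt_id t).const_mul (2 * a * ‖v‖ ^ 2))
  have hslope_mono : Monotone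
      (fun t : ℝ => fderiv ℝ f (t • v) v - 2 * a * ‖v‖ ^ 2 * t) := by
    refine monotone_of_hasDerivAt_nonneg hslope fun t => ?_
    have := hconv (t • v) v
    rw [iteratedFDeriv_two_apply] at this
    simpa using this
  have hrem (t : ℝ) : HasDerivAt
      (fun t : ℝ => f (t • v) - fderiv ℝ f 0 v * t - a * ‖v‖ ^ 2 * t ^ 2)
      (fderiv ℝ f (t • v) v - fderiv ℝ f 0 v - a * ‖v‖ ^ 2 * (2 * t)) t := by
    simpa using ((h1 t).fun_sub ((hasDerivAt_id t).const_mul (fderiv ℝ f 0 v))).fun_sub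
      ((hasDerivAt_pow 2 t).const_mul (a * ‖v‖ ^ 2))
  have hrem_mono : MonotoneOn
      (fun t : ℝ => f (t • v) - fderiv ℝ f 0 v * t - a * ‖v‖ ^ 2 * t ^ 2) (Icc 0 1) := by
    refine monotoneOn_of_hasDerivWithinAt_nonneg (convex_Icc 0 1)
      (fun t _ => (hrem t).continuousAt.continuousWithinAt)
      (fun t _ => (hrem t).hasDerivWithinAt) fun t ht => ?_
    rw [interior_Icc] at ht
    have := hslope_mono ht.1.le
    simp only [zero_smul, mul_zero, sub_zero] at this
    linarith
  have := hrem_mono (left_mem_Icc.2 zero_le_one) (right_mem_Icc.2 zero_le_one) zero_le_one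
  simp only [zero_smul, one_smul] at this
  linarith

/-- **Lower bound for the free-time action in terms of length (mountain-pass geometry
estimate).** Let `L : ℝⁿ × ℝⁿ → ℝ` be a `C²` Lagrangian with `D²_{vv}L(q,v)[u,u] ≥ 2a‖u‖²`.
Suppose the energy at zero velocity `E(q,0) = −L(q,0)` is at most `c_E` and the norm of
`θ_q = d_vL(q,0)` is at most `c_θ` for all `q` in a set `U`. Then for every `C¹` curve
`γ : [0,T] → U`, the free-time action `A_k(γ)` satisfies
`A_k(γ) ≥ (k − c_E)·T + (a/T)·l(γ)² − c_θ·l(γ)`; consequently, if `k ≥ c_E` and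
`2√(a(k − c_E)) ≥ c_θ`, then `A_k(γ) ≥ (2√(a(k − c_E)) − c_θ)·l(γ) ≥ 0`. -/
theorem freeTimeAction_lower_bound
    (n : ℕ) (hn : 1 ≤ n) (a : ℝ) (ha : 0 < a)
    (L : EuclideanSpace ℝ (Fin n) × EuclideanSpace ℝ (Fin n) → ℝ)
    (hL : ContDiff ℝ 2 L)
    (hconv : ∀ (q v u : EuclideanSpace ℝ (Fin n)),
      2 * a * ‖u‖ ^ 2 ≤ iteratedFDeriv ℝ 2 (fun w => L (q, w)) v ![u, u])
    (U : Set (EuclideanSpace ℝ (Fin n))) (cE cθ : ℝ)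
    (hcE : ∀ q ∈ U, -L (q, 0) ≤ cE)
    (hcθ : ∀ q ∈ U, ‖fderiv ℝ (fun v => L (q, v)) 0‖ ≤ cθ)
    (k : ℝ) (T : ℝ) (hT : 0 < T)
    (γ γ' : ℝ → EuclideanSpace ℝ (Fin n))
    (hγ : ∀ t ∈ Set.Icc (0:ℝ) T, HasDerivWithinAt γ (γ' t) (Set.Icc 0 T) t)
    (hγ' : ContinuousOn γ' (Set.Icc 0 T))
    (hγU : ∀ t ∈ Set.Icc (0:ℝ) T, γ t ∈ U) :
    (k - cE) * T + (a / T) * (∫ t in (0:ℝ)..T, ‖γ' t‖) ^ 2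
        - cθ * (∫ t in (0:ℝ)..T, ‖γ' t‖)
      ≤ ∫ t in (0:ℝ)..T, (L (γ t, γ' t) + k) ∧
    (cE ≤ k → cθ ≤ 2 * Real.sqrt (a * (k - cE)) →
      (2 * Real.sqrt (a * (k - cE)) - cθ) * (∫ t in (0:ℝ)..T, ‖γ' t‖)
          ≤ ∫ t in (0:ℝ)..T, (L (γ t, γ' t) + k) ∧
        0 ≤ (2 * Real.sqrt (a * (k - cE)) - cθ) * (∫ t in (0:ℝ)..T, ‖γ' t‖)) := by
  have hseg (q : EuclideanSpace ℝ (Fin n)) : ContDiff ℝ 2 (fun w => L (q, w)) :=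
    hL.comp (contDiff_const.prodMk contDiff_id)
  have hγc : ContinuousOn γ (Icc 0 T) := fun t ht => (hγ t ht).continuousWithinAt
  have hnorm : IntervalIntegrable (fun t => ‖γ' t‖) MeasureTheory.volume 0 T :=
    ContinuousOn.intervalIntegrable_of_Icc hT.le hγ'.norm
  have hact : IntervalIntegrable (fun t => L (γ t, γ' t) + k) MeasureTheory.volume 0 T :=
    ContinuousOn.intervalIntegrable_of_Icc hT.le
      ((hL.continuous.comp_continuousOn (hγc.prodMk hγ')).add continuousOn_const)
  set l := ∫ t in (0:ℝ)..T, ‖γ' t‖ with hl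
  have hl0 : 0 ≤ l := intervalIntegral.integral_nonneg hT.le fun t _ => norm_nonneg _
  -- Bound the quadratic term below by its tangent line at the mean speed `l / T`.
  have hpt : ∀ t ∈ Icc (0:ℝ) T,
      (k - cE - a * (l / T) ^ 2) + (2 * a * (l / T) - cθ) * ‖γ' t‖ ≤ L (γ t, γ' t) + k := by
    intro t ht
    have hlow := add_fderiv_add_mul_norm_sq_le (hseg (γ t)) (hconv (γ t)) (γ' t)
    have hE := hcE _ (hγU t ht)
    have hθ : -(cθ * ‖γ' t‖) ≤ fderiv ℝ (fun v => L (γ t, v)) 0 (γ' t) :=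
      (abs_le.1 ((fderiv ℝ (fun v => L (γ t, v)) 0).le_of_opNorm_le
        (hcθ _ (hγU t ht)) (γ' t))).1
    have hsq := mul_nonneg ha.le (sq_nonneg (‖γ' t‖ - l / T))
    linarith
  have hmain : (k - cE) * T + (a / T) * l ^ 2 - cθ * l
      ≤ ∫ t in (0:ℝ)..T, (L (γ t, γ' t) + k) := by
    refine le_trans (le_of_eq ?_) (intervalIntegral.integral_mono_on hT.le
      (intervalIntegrable_const.add (hnorm.const_mul _)) hact hpt)
    rw [intervalIntegral.integral_add intervalIntegrable_const (hnorm.const_mul _),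
      intervalIntegral.integral_const, intervalIntegral.integral_const_mul, ← hl, smul_eq_mul]
    field_simp
    ring
  refine ⟨hmain, fun hk hc => ⟨le_trans ?_ hmain, mul_nonneg (sub_nonneg.2 hc) hl0⟩⟩
  set s := Real.sqrt (a * (k - cE)) with hs
  have hs2 : s ^ 2 = a * (k - cE) := Real.sq_sqrt (mul_nonneg ha.le (sub_nonneg.2 hk))
  have hsq : 0 ≤ (s * T - a * l) ^ 2 / (a * T) := by positivity
  have hexp : (s * T - a * l) ^ 2 / (a * T)
      = (k - cE) * T + (a / T) * l ^ 2 - 2 * s * l := by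
    field_simp
    linear_combination T ^ 2 * hs2
  linarith
end
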